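/- arXiv:2002.04376 — 2 statements merged into one kernel-verified Lean document; each statement's English description precedes it below -/
import Mathlib

section
/- In the language of rings, an algebraically closed field K is existentially closed in every extension field F: every existential first-order sentence in the language of rings with parameters from K that holds in F also holds in K. -/
/-- In the language of rings, an algebraically closed field `K` is existentially closed in
every extension field `F`: every existential sentence in the language of rings with parameters
from `K` which holds in `F` also holds in `K`. (An existential sentence with parameters from
`K` is equivalent, over fields, to the solvability of a finite system of polynomial equations
and inequations with coefficients in `K`.) -/
theorem algClosed_existentially_closed_in_extensions
    (K F : Type*) [Field K] [IsAlgClosed K] [Field F] [Algebra K F]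
    (n k l : ℕ) (p : Fin k → MvPolynomial (Fin n) K) (q : Fin l → MvPolynomial (Fin n) K)
    (hF : ∃ x : Fin n → F,
      (∀ i, MvPolynomial.aeval x (p i) = 0) ∧ ∀ j, MvPolynomial.aeval x (q j) ≠ 0) :
    ∃ x : Fin n → K,
      (∀ i, MvPolynomial.aeval x (p i) = 0) ∧ ∀ j, MvPolynomial.aeval x (q j) ≠ 0 := by
  obtain ⟨x, hp, hq⟩ := hF
  let P : Ideal (MvPolynomial (Fin n) K) :=
    RingHom.ker (MvPolynomial.aeval x : MvPolynomial (Fin n) K →ₐ[K] F)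
  have hP : P.IsPrime := RingHom.ker_isPrime _
  have h := MvPolynomial.IsPrime.vanishingIdeal_zeroLocus (K := K) P
  have hn : (∏ j, q j) ∉ P := by
    intro hm
    have hm' : MvPolynomial.aeval x (∏ j, q j) = 0 := hm
    rw [map_prod, Finset.prod_eq_zero_iff] at hm'
    obtain ⟨j, -, hj⟩ := hm'
    exact hq j hj
  rw [← h, MvPolynomial.mem_vanishingIdeal_iff] at hn
  push Not at hn
  obtain ⟨y, hy, hne⟩ := hn
  refine ⟨y, fun i => MvPolynomial.mem_zeroLocus_iff.1 hy _ (hp i), fun j hj => hne ?_⟩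
  rw [map_prod]
  exact Finset.prod_eq_zero (Finset.mem_univ j) hj
end

section
/- In the language of rings with a relation symbol for a valuation, an algebraically closed field K equipped with a nontrivial valuation is existentially closed in every valued extension field F: every existential sentence in this language with parameters from K that holds in the valued field F also holds in the valued field K. -/
/-- The divisibility relation of the valuation associated with the valuation ring `O`:
`vle O a b` means `v(a) ≤ v(b)`. -/
def vle {F : Type*} [Field F] (O : ValuationSubring F) (a b : F) : Prop :=
  ∃ c ∈ O, b = a * c

open Polynomial

/-- Elements of `E` in the maximal ideal of `OE` go to the maximal ideal of `V`. -/
lemma ec_nonunits_iff {E N : Type*} [Field E] [Field N] (φ : E →+* N)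
    (OE : ValuationSubring E) (V : ValuationSubring N)
    (hV : ∀ e, e ∈ OE ↔ φ e ∈ V) (e : E) :
    OE.valuation e < 1 ↔ V.valuation (φ e) < 1 := by
  rw [← ValuationSubring.mem_nonunits_iff, ← ValuationSubring.mem_nonunits_iff,
    ValuationSubring.mem_nonunits_iff_or, ValuationSubring.mem_nonunits_iff_or, hV, map_inv₀,
    map_eq_zero]

/-- The intersection of all valuation rings above `OE`. -/
def ecB {E : Type*} (N : Type*) [Field E] [Field N] [Algebra E N] (OE : ValuationSubring E) :
    Subring N where
  carrier := {z | ∀ V : ValuationSubring N, (∀ e ∈ OE, algebraMap E N e ∈ V) → z ∈ V}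
  mul_mem' ha hb V hV := V.mul_mem _ _ (ha V hV) (hb V hV)
  one_mem' V _ := V.one_mem
  add_mem' ha hb V hV := V.add_mem _ _ (ha V hV) (hb V hV)
  zero_mem' V _ := V.zero_mem
  neg_mem' ha V hV := V.neg_mem _ (ha V hV)

lemma ec_normalize {E N : Type*} [Field E] [Field N] [Algebra E N] (OE : ValuationSubring E)
    {x : N} (hx : IsAlgebraic E x) :
    ∃ (n j : ℕ) (b : ℕ → E), j < n ∧ (∀ i, b i ∈ OE) ∧ b j = 1 ∧
      (∀ i, j < i → OE.valuation (b i) < 1) ∧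
      ∑ i ∈ Finset.range n, algebraMap E N (b i) * x ^ i = 0 := by
  obtain ⟨f, hf0, hf⟩ := hx
  classical
  let v := OE.valuation
  obtain ⟨m, hm, hmax⟩ := Finset.exists_max_image f.support (fun i => v (f.coeff i))
    (by simpa using hf0)
  have hmax' : ∀ i, v (f.coeff i) ≤ v (f.coeff m) := by
    intro i
    by_cases h : i ∈ f.support
    · exact hmax i h
    · rw [notMem_support_iff.mp h]; simp
  let T := f.support.filter (fun i => v (f.coeff i) = v (f.coeff m))
  have hT : T.Nonempty := ⟨m, by simp only [T, Finset.mem_filter, hm, true_and]⟩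
  let j := T.max' hT
  have hjT : j ∈ T := T.max'_mem hT
  have hj : j ∈ f.support ∧ v (f.coeff j) = v (f.coeff m) := by
    simpa only [T, Finset.mem_filter] using hjT
  have hj0 : f.coeff j ≠ 0 := mem_support_iff.mp hj.1
  have hvj : 0 < v (f.coeff j) := by
    rw [zero_lt_iff]; exact (Valuation.ne_zero_iff _).mpr hj0
  refine ⟨f.natDegree + 1, j, fun i => f.coeff i / f.coeff j, ?_, ?_, ?_, ?_, ?_⟩
  · exact Nat.lt_succ_of_le (le_natDegree_of_mem_supp _ hj.1)
  · intro i
    rw [← ValuationSubring.valuation_le_one_iff, map_div₀]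
    exact div_le_one_of_le₀ ((hmax' i).trans hj.2.ge) zero_le
  · exact div_self hj0
  · intro i hi
    rw [map_div₀]
    rw [div_lt_one₀ hvj]
    refine lt_of_le_of_ne ((hmax' i).trans hj.2.ge) fun h => ?_
    have : i ∈ T := by
      simp only [T, Finset.mem_filter, mem_support_iff]
      refine ⟨fun h0 => ?_, h.trans hj.2⟩
      have : v (f.coeff i) = 0 := by rw [h0, map_zero]
      have h2 : v (f.coeff i) = v (f.coeff j) := h
      rw [this] at h2
      exact hvj.ne h2
    exact absurd (T.le_max' i this) (not_le.mpr hi)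
  · rw [aeval_eq_sum_range] at hf
    have : ∑ i ∈ Finset.range (f.natDegree + 1), algebraMap E N (f.coeff i / f.coeff j) * x ^ i
       = (algebraMap E N (f.coeff j))⁻¹ * ∑ i ∈ Finset.range (f.natDegree + 1),
          f.coeff i • x ^ i := by
      rw [Finset.mul_sum]
      refine Finset.sum_congr rfl fun i _ => ?_
      rw [Algebra.smul_def, map_div₀]; ring
    rw [this, hf, mul_zero]

lemma ec_frac {E N : Type*} [Field E] [Field N] [Algebra E N] (OE : ValuationSubring E)
    {x : N} (hx : IsAlgebraic E x) :
    ∃ y z : N, y ∈ ecB N OE ∧ z ∈ ecB N OE ∧ x * y = z ∧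
      ∀ V : ValuationSubring N, (∀ e, e ∈ OE ↔ algebraMap E N e ∈ V) → x ∈ V →
        V.valuation (y - 1) < 1 := by
  by_cases hx0 : x = 0
  · exact ⟨1, 0, one_mem _, zero_mem _, by simp [hx0], fun V _ _ => by simp⟩
  obtain ⟨n, j, b, hjn, hb, hbj, hbl, hsum⟩ := ec_normalize (N := N) OE hx
  let y := ∑ i ∈ Finset.Ico j n, algebraMap E N (b i) * x ^ (i - j)
  have hy1 : x ^ j * y = ∑ i ∈ Finset.Ico j n, algebraMap E N (b i) * x ^ i := by
    simp only [y]
    rw [Finset.mul_sum]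
    refine Finset.sum_congr rfl fun i hi => ?_
    rw [mul_left_comm, ← pow_add, Nat.add_sub_cancel' (Finset.mem_Ico.mp hi).1]
  have hz1 : x * y = - ∑ i ∈ Finset.range j, algebraMap E N (b i) * (x⁻¹) ^ (j - 1 - i) := by
    have h1 : x ^ j * (x * y) = x ^ j *
        (- ∑ i ∈ Finset.range j, algebraMap E N (b i) * (x⁻¹) ^ (j - 1 - i)) := by
      rw [mul_left_comm, hy1]
      have h2 := Finset.sum_range_add_sum_Ico (fun i => algebraMap E N (b i) * x ^ i) hjn.le
      rw [hsum] at h2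
      rw [eq_neg_of_add_eq_zero_right h2, mul_neg, mul_neg, Finset.mul_sum, Finset.mul_sum]
      congr 1
      refine Finset.sum_congr rfl fun i hi => ?_
      have hi' : j = i + 1 + (j - 1 - i) := by have := Finset.mem_range.mp hi; omega
      have : x ^ j * (x⁻¹) ^ (j - 1 - i) = x ^ (i + 1) := by
        conv_lhs => rw [hi', pow_add]
        rw [mul_assoc, inv_pow]
        rw [show i + 1 + (j - 1 - i) - 1 - i = j - 1 - i by omega]
        rw [mul_inv_cancel₀ (pow_ne_zero _ hx0), mul_one]
      rw [mul_left_comm (x ^ j), this]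
      ring
    exact mul_left_cancel₀ (pow_ne_zero _ hx0) h1
  have key : ∀ V : ValuationSubring N, (∀ e ∈ OE, algebraMap E N e ∈ V) → y ∈ V ∧ x * y ∈ V := by
    intro V hV
    rcases V.mem_or_inv_mem x with h | h
    · have : y ∈ V := sum_mem fun i _ => mul_mem (hV _ (hb i)) (pow_mem h _)
      exact ⟨this, mul_mem h this⟩
    · have h2 : x * y ∈ V := by
        rw [hz1]
        exact neg_mem (sum_mem fun i _ => mul_mem (hV _ (hb i)) (pow_mem h _))
      refine ⟨?_, h2⟩
      have := mul_mem h h2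
      rwa [inv_mul_cancel_left₀ hx0] at this
  refine ⟨y, x * y, fun V hV => (key V hV).1, fun V hV => (key V hV).2, rfl, ?_⟩
  intro V hV hxV
  have h3 : y - 1 = ∑ i ∈ Finset.Ico (j + 1) n, algebraMap E N (b i) * x ^ (i - j) := by
    simp only [y]
    rw [Finset.sum_eq_sum_Ico_succ_bot hjn, hbj]
    simp
  rw [h3]
  refine Valuation.map_sum_lt _ one_ne_zero fun i hi => ?_
  rw [map_mul, map_pow]
  have h4 := (ec_nonunits_iff (algebraMap E N) OE V hV (b i)).mp
    (hbl i (by have := Finset.mem_Ico.mp hi; omega))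
  exact mul_lt_one_of_lt_of_le h4 (pow_le_one₀ zero_le ((V.valuation_le_one_iff x).mpr hxV))

/-- the center on `B` of a valuation ring above `OE` -/
def ecP {E N : Type*} [Field E] [Field N] [Algebra E N] (OE : ValuationSubring E)
    (V : ValuationSubring N) (hV : ∀ e, e ∈ OE ↔ algebraMap E N e ∈ V) : Ideal (ecB N OE) where
  carrier := {b | V.valuation (b : N) < 1}
  add_mem' {a b} ha hb := by
    change V.valuation (a : N) < 1 at ha
    change V.valuation (b : N) < 1 at hb
    change V.valuation ((a : N) + (b : N)) < 1
    exact Valuation.map_add_lt _ ha hb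
  zero_mem' := by simp
  smul_mem' c x hx := by
    have hc : V.valuation (c : N) ≤ 1 :=
      (V.valuation_le_one_iff _).mpr (c.2 V fun e he => (hV e).mp he)
    change V.valuation (x : N) < 1 at hx
    change V.valuation ((c : N) * (x : N)) < 1
    rw [map_mul, mul_comm]
    exact mul_lt_one_of_lt_of_le hx hc

lemma ecP_prime {E N : Type*} [Field E] [Field N] [Algebra E N] (OE : ValuationSubring E)
    (V : ValuationSubring N) (hV : ∀ e, e ∈ OE ↔ algebraMap E N e ∈ V) :
    (ecP OE V hV).IsPrime := by
  refine ⟨?_, ?_⟩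
  · rw [Ideal.ne_top_iff_one]
    change ¬ V.valuation ((1 : ecB N OE) : N) < 1
    simp
  · intro a b hab
    change V.valuation ((a * b : ecB N OE) : N) < 1 at hab
    change V.valuation (a : N) < 1 ∨ V.valuation (b : N) < 1
    by_contra! h
    rw [Subring.coe_mul, map_mul] at hab
    exact absurd hab (not_lt.mpr (one_le_mul h.1 h.2))

lemma ec_conj {E N : Type*} [Field E] [Field N] [Algebra E N] [FiniteDimensional E N]
    [Normal E N] (OE : ValuationSubring E)
    (V W : ValuationSubring N) (hV : ∀ e, e ∈ OE ↔ algebraMap E N e ∈ V)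
    (hW : ∀ e, e ∈ OE ↔ algebraMap E N e ∈ W) :
    ∃ σ : N ≃ₐ[E] N, ∀ z, z ∈ V ↔ σ z ∈ W := by
  classical
  let W' : (N ≃ₐ[E] N) → ValuationSubring N := fun σ => W.comap (σ : N →+* N)
  have hW'm : ∀ σ z, z ∈ W' σ ↔ σ z ∈ W := fun σ z => Iff.rfl
  have hW' : ∀ σ e, e ∈ OE ↔ algebraMap E N e ∈ W' σ := by
    intro σ e; rw [hW'm, AlgEquiv.commutes, hW]
  have hW'v : ∀ σ z, (W' σ).valuation z < 1 ↔ W.valuation (σ z) < 1 := fun σ z =>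
    ec_nonunits_iff (σ : N →+* N) (W' σ) W (fun e => Iff.rfl) z
  have hBσ : ∀ (σ : N ≃ₐ[E] N) (z : N), z ∈ ecB N OE → σ z ∈ ecB N OE := by
    intro σ z hz U hU
    have := hz (U.comap (σ : N →+* N)) (fun e he => by
      change σ (algebraMap E N e) ∈ U
      rw [AlgEquiv.commutes]; exact hU e he)
    exact this
  have hcov : ((ecP OE V hV : Ideal (ecB N OE)) : Set (ecB N OE)) ⊆
      ⋃ σ ∈ (Finset.univ : Finset (N ≃ₐ[E] N)), (ecP OE (W' σ) (hW' σ) : Set (ecB N OE)) := by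
    intro b hb
    replace hb : V.valuation (b : N) < 1 := hb
    let f := minpoly E (b : N)
    have hbi : IsIntegral E (b : N) := Algebra.IsIntegral.isIntegral _
    have hsp : (f.map (algebraMap E N)).Splits := Normal.splits inferInstance _
    have hmon : (f.map (algebraMap E N)).Monic := (minpoly.monic hbi).map _
    have hprod := hsp.coeff_zero_eq_prod_roots_of_monic hmon
    have hroot : ∀ r ∈ (f.map (algebraMap E N)).roots, ∃ σ : N ≃ₐ[E] N, σ (b : N) = r := by
      intro r hr
      refine minpoly.exists_algEquiv_of_root' hbi.isAlgebraic ?_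
      rw [mem_roots hmon.ne_zero, IsRoot.def, eval_map_algebraMap] at hr
      exact hr
    have hrB : ∀ r ∈ (f.map (algebraMap E N)).roots, r ∈ ecB N OE := by
      intro r hr
      obtain ⟨σ, rfl⟩ := hroot r hr
      exact hBσ σ _ b.2
    have hbr : (b : N) ∈ (f.map (algebraMap E N)).roots := by
      rw [mem_roots hmon.ne_zero, IsRoot.def, eval_map_algebraMap]
      exact minpoly.aeval _ _
    obtain ⟨R, hR⟩ := Multiset.exists_cons_of_mem hbr
    have hvp : V.valuation (f.map (algebraMap E N)).roots.prod < 1 := by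
      rw [hR, Multiset.prod_cons, map_mul]
      refine mul_lt_one_of_lt_of_le hb ((V.valuation_le_one_iff _).mpr ?_)
      refine multiset_prod_mem _ fun r hr => ?_
      exact hrB r (by rw [hR]; exact Multiset.mem_cons_of_mem hr) V fun e he => (hV e).mp he
    have hsgn : ∀ (U : ValuationSubring N) (k : ℕ) (c : N),
        U.valuation ((-1) ^ k * c) = U.valuation c := by
      intro U k c
      rw [map_mul, map_pow, Valuation.map_neg, map_one, one_pow, one_mul]
    have hv2 : V.valuation (algebraMap E N (f.coeff 0)) < 1 := by
      rw [← coeff_map, hprod, hsgn]; exact hvp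
    have hw2 : W.valuation (algebraMap E N (f.coeff 0)) < 1 :=
      (ec_nonunits_iff _ OE W hW _).mp ((ec_nonunits_iff _ OE V hV _).mpr hv2)
    rw [← coeff_map, hprod, hsgn] at hw2
    have : ∃ r ∈ (f.map (algebraMap E N)).roots, W.valuation r < 1 := by
      by_contra! hcon
      refine absurd hw2 (not_lt.mpr ?_)
      rw [map_multiset_prod]
      refine Multiset.one_le_prod_of_one_le ?_
      intro g hg
      obtain ⟨r, hr, rfl⟩ := Multiset.mem_map.mp hg
      exact hcon r hr
    obtain ⟨r, hr, hrw⟩ := this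
    obtain ⟨σ, rfl⟩ := hroot r hr
    simp only [Set.mem_iUnion]
    exact ⟨σ, Finset.mem_univ _, (hW'v σ _).mpr hrw⟩
  obtain ⟨σ, -, hσ⟩ := (Ideal.subset_union_prime (s := (Finset.univ : Finset (N ≃ₐ[E] N)))
    (f := fun σ => ecP OE (W' σ) (hW' σ)) 1 1 (fun σ _ _ _ => ecP_prime _ _ _)).mp hcov
  refine ⟨σ, ?_⟩
  have hle : ∀ x, x ∈ W' σ → x ∈ V := by
    intro x hx
    obtain ⟨y, z, hy, hz, hxy, hyv⟩ := ec_frac (N := N) OE (Algebra.IsAlgebraic.isAlgebraic x)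
    have h1 := hyv (W' σ) (hW' σ) hx
    have h2 : ¬ (W' σ).valuation y < 1 := by
      intro h
      have h3 := Valuation.map_sub_lt _ h h1
      simp at h3
    have h3 : ¬ V.valuation y < 1 := fun h => h2 (hσ (show (⟨y, hy⟩ : ecB N OE) ∈ ecP OE V hV from h))
    have h4 : V.valuation z ≤ 1 := (V.valuation_le_one_iff _).mpr (hz V fun e he => (hV e).mp he)
    rw [← hxy, map_mul] at h4
    rw [← V.valuation_le_one_iff]
    by_contra! h5
    exact absurd h4 (not_le.mpr (one_lt_mul_of_lt_of_le h5 (not_lt.mp h3)))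
  intro x
  rw [← hW'm]
  refine ⟨fun hx => ?_, hle x⟩
  by_contra hxW
  have hx0 : x ≠ 0 := by rintro rfl; exact hxW (zero_mem _)
  have hu : (W' σ).valuation x⁻¹ < 1 := by
    rw [← ValuationSubring.mem_nonunits_iff, ValuationSubring.inv_mem_nonunits_iff]
    exact Or.inr hxW
  obtain ⟨y, z, hy, hz, hxy, hyv⟩ := ec_frac (N := N) OE (Algebra.IsAlgebraic.isAlgebraic x)
  have h1 := hyv V hV hx
  have h2 : y = x⁻¹ * z := by rw [← hxy, inv_mul_cancel_left₀ hx0]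
  have h3 : (W' σ).valuation y < 1 := by
    rw [h2, map_mul]
    exact mul_lt_one_of_lt_of_le hu
      (((W' σ).valuation_le_one_iff _).mpr (hz _ fun e he => (hW' σ e).mp he))
  have h4 : (W' σ).valuation (y - 1) = 1 := by
    rw [Valuation.map_sub_swap]
    exact Valuation.map_one_sub_of_lt _ h3
  have h5 : (y - 1)⁻¹ ∈ V := by
    apply hle
    rw [← ValuationSubring.valuation_le_one_iff, map_inv₀, h4, inv_one]
  rw [← ValuationSubring.mem_nonunits_iff, ValuationSubring.mem_nonunits_iff_or] at h1
  rcases h1 with h | h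
  · rw [h, map_zero] at h4
    exact zero_ne_one h4
  · exact h h5

lemma ec_avoid {K Γ : Type*} [Field K] [IsAlgClosed K] [LinearOrderedCommGroupWithZero Γ]
    (u : Valuation K Γ) (S : Finset K) (hS : ∀ s ∈ S, u s ≤ 1) :
    ∃ ε : K, u ε = 1 ∧ ∀ s ∈ S, u (ε - s) = 1 := by
  classical
  let S' := insert 0 S
  have hS' : ∀ s ∈ S', u s ≤ 1 := by
    intro s hs
    rcases Finset.mem_insert.mp hs with rfl | h
    · simp
    · exact hS s h
  let f : K[X] := ∏ s ∈ S', (X - C s)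
  have hfm : f.Monic := monic_prod_of_monic _ _ fun s _ => monic_X_sub_C s
  have hfd : f.natDegree = S'.card := by
    simp only [f]
    rw [natDegree_prod_of_monic _ _ fun s _ => monic_X_sub_C s]
    simp
  have hcard : 0 < S'.card := Finset.card_pos.mpr ⟨0, Finset.mem_insert_self _ _⟩
  obtain ⟨ε, hε⟩ := IsAlgClosed.exists_root (f - C 1) (by
    have h0 : 0 < f.natDegree := by rw [hfd]; exact hcard
    have : (f - C 1).natDegree = f.natDegree := natDegree_sub_C
    intro h
    have h3 : (f - C 1).natDegree = 0 := natDegree_eq_of_degree_eq_some h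
    omega)
  have hprod : ∏ s ∈ S', (ε - s) = 1 := by
    have : eval ε (f - C 1) = 0 := hε
    simp only [f, eval_sub, eval_prod, eval_X, eval_C] at this
    exact sub_eq_zero.mp this
  have hup : ∏ s ∈ S', u (ε - s) = 1 := by rw [← map_prod, hprod, map_one]
  have hle : u ε ≤ 1 := by
    by_contra! h
    have h1 : ∀ s ∈ S', 1 < u (ε - s) := by
      intro s hs
      rw [Valuation.map_sub_eq_of_lt_left _ ((hS' s hs).trans_lt h)]
      exact h
    have h0 : 0 ∈ S' := Finset.mem_insert_self _ _
    rw [← Finset.mul_prod_erase _ _ h0] at hup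
    have h2 : 1 ≤ ∏ s ∈ S'.erase 0, u (ε - s) :=
      Finset.one_le_prod' fun s hs => (h1 s (Finset.mem_of_mem_erase hs)).le
    exact (one_lt_mul_of_lt_of_le (h1 0 h0) h2).ne' hup
  have hall : ∀ s ∈ S', u (ε - s) = 1 := by
    intro s hs
    have hle' : ∀ r ∈ S', u (ε - r) ≤ 1 := fun r hr =>
      (Valuation.map_sub _ _ _).trans (max_le hle (hS' r hr))
    refine le_antisymm (hle' s hs) ?_
    by_contra! h
    rw [← Finset.mul_prod_erase _ _ hs] at hup
    have h2 : ∏ r ∈ S'.erase s, u (ε - r) ≤ 1 :=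
      Finset.prod_le_one' fun r hr => hle' r (Finset.mem_of_mem_erase hr)
    exact (mul_lt_one_of_lt_of_le h h2).ne hup
  refine ⟨ε, ?_, fun s hs => hall s (Finset.mem_insert_of_mem hs)⟩
  have := hall 0 (Finset.mem_insert_self _ _)
  rwa [sub_zero] at this

lemma ec_cut {K Γ : Type*} [Field K] [IsAlgClosed K] [LinearOrderedCommGroupWithZero Γ]
    (u : Valuation K Γ) (hu : ∃ p : K, p ≠ 0 ∧ u p < 1) (β : Γ) (hβ : β ≠ 0) (D : Finset K) :
    ∃ b : K, b ≠ 0 ∧ ∀ d ∈ D, (u d ≤ β ↔ u d ≤ u b) ∧ (β ≤ u d ↔ u b ≤ u d) ∧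
      (u d ≤ β → u (b - d) = u b) := by
  classical
  by_cases hc : ∃ d : K, u d = β
  · obtain ⟨d, rfl⟩ := hc
    have hd : d ≠ 0 := fun h => hβ (by rw [h, map_zero])
    obtain ⟨ε, hε, hεs⟩ := ec_avoid u ((D.filter fun e => u e ≤ u d).image fun e => e / d) (by
      intro s hs
      obtain ⟨e, he, rfl⟩ := Finset.mem_image.mp hs
      rw [map_div₀]
      exact div_le_one_of_le₀ (Finset.mem_filter.mp he).2 zero_le)
    have hub : u (d * ε) = u d := by rw [map_mul, hε, mul_one]
    refine ⟨d * ε, ?_, ?_⟩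
    · rw [← Valuation.ne_zero_iff u, hub]; exact hβ
    · intro e he
      rw [hub]
      refine ⟨Iff.rfl, Iff.rfl, fun hle => ?_⟩
      have := hεs (e / d) (Finset.mem_image.mpr ⟨e, Finset.mem_filter.mpr ⟨he, hle⟩, rfl⟩)
      rw [show d * ε - e = d * (ε - e / d) by field_simp, map_mul, this, mul_one]
  · push Not at hc
    obtain ⟨p, hp0, hp1⟩ := hu
    have hup : 0 < u p := zero_lt_iff.mpr ((Valuation.ne_zero_iff u).mpr hp0)
    suffices h : ∃ b : K, b ≠ 0 ∧ ∀ d ∈ D, (u d < β → u d < u b) ∧ (β < u d → u b < u d) by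
      obtain ⟨b, hb0, hb⟩ := h
      refine ⟨b, hb0, fun d hd => ?_⟩
      rcases lt_or_gt_of_ne (hc d) with h | h
      · have h' := (hb d hd).1 h
        refine ⟨⟨fun _ => h'.le, fun _ => h.le⟩, ⟨fun h2 => absurd h2 (not_le.mpr h),
          fun h2 => absurd h2 (not_le.mpr h')⟩, fun _ => ?_⟩
        exact Valuation.map_sub_eq_of_lt_left _ h'
      · have h' := (hb d hd).2 h
        exact ⟨⟨fun h2 => absurd h2 (not_le.mpr h), fun h2 => absurd h2 (not_le.mpr h')⟩,
          ⟨fun _ => h'.le, fun _ => h.le⟩, fun h2 => absurd h2 (not_le.mpr h)⟩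
    let L := (insert 0 D).filter fun d => u d < β
    let U := D.filter fun d => β < u d
    have hL : L.Nonempty := ⟨0, by
      simp only [L, Finset.mem_filter, Finset.mem_insert, true_or, true_and, map_zero]
      exact zero_lt_iff.mpr hβ⟩
    obtain ⟨l, hl, hlm⟩ := Finset.exists_max_image L u hL
    have hlβ : u l < β := (Finset.mem_filter.mp hl).2
    have hLD : ∀ d ∈ D, u d < β → u d ≤ u l := fun d hd h =>
      hlm d (Finset.mem_filter.mpr ⟨Finset.mem_insert_of_mem hd, h⟩)
    rcases U.eq_empty_or_nonempty with hU | hU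
    · have hU' : ∀ d ∈ D, ¬ β < u d := fun d hd h => by
        have : d ∈ U := Finset.mem_filter.mpr ⟨hd, h⟩
        rw [hU] at this
        exact absurd this (Finset.notMem_empty _)
      obtain ⟨b, hb0, hb⟩ : ∃ b : K, b ≠ 0 ∧ u l < u b := by
        by_cases h0 : l = 0
        · exact ⟨1, one_ne_zero, by rw [h0]; simp⟩
        · refine ⟨l / p, div_ne_zero h0 hp0, ?_⟩
          rw [map_div₀, lt_div_iff₀ hup]
          exact mul_lt_of_lt_one_right (zero_lt_iff.mpr ((Valuation.ne_zero_iff u).mpr h0)) hp1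
      exact ⟨b, hb0, fun d hd => ⟨fun h => (hLD d hd h).trans_lt hb, fun h => absurd h (hU' d hd)⟩⟩
    · obtain ⟨m, hm, hmm⟩ := Finset.exists_min_image U u hU
      have hmβ : β < u m := (Finset.mem_filter.mp hm).2
      have hum : 0 < u m := lt_of_le_of_lt zero_le hmβ
      have hm0 : m ≠ 0 := (Valuation.ne_zero_iff u).mp hum.ne'
      have hUD : ∀ d ∈ D, β < u d → u m ≤ u d := fun d hd h =>
        hmm d (Finset.mem_filter.mpr ⟨hd, h⟩)
      obtain ⟨b, hb0, hb1, hb2⟩ : ∃ b : K, b ≠ 0 ∧ u l < u b ∧ u b < u m := by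
        by_cases h0 : l = 0
        · refine ⟨m * p, mul_ne_zero hm0 hp0, ?_, ?_⟩
          · rw [h0, map_zero, map_mul]; exact mul_pos hum hup
          · rw [map_mul]; exact mul_lt_of_lt_one_right hum hp1
        · obtain ⟨b, hb⟩ := IsAlgClosed.exists_pow_nat_eq (l * m) (n := 2) (by norm_num)
          have hul : 0 < u l := zero_lt_iff.mpr ((Valuation.ne_zero_iff u).mpr h0)
          have hb' : u b ^ 2 = u l * u m := by rw [← map_pow, hb, map_mul]
          have hlm' := hlβ.trans hmβ
          refine ⟨b, ?_, ?_, ?_⟩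
          · rintro rfl
            have : l * m = 0 := by rw [← hb]; simp
            exact mul_ne_zero h0 hm0 this
          · rw [← pow_lt_pow_iff_left₀ zero_le zero_le (two_ne_zero), hb', sq]
            exact mul_lt_mul_of_pos_left hlm' hul
          · rw [← pow_lt_pow_iff_left₀ zero_le zero_le (two_ne_zero), hb', sq]
            exact mul_lt_mul_of_pos_right hlm' hum
      exact ⟨b, hb0, fun d hd => ⟨fun h => (hLD d hd h).trans_lt hb1,
        fun h => hb2.trans_le (hUD d hd h)⟩⟩

lemma ec_cmp {K Γ : Type*} [Field K] [IsAlgClosed K] [LinearOrderedCommGroupWithZero Γ]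
    (u : Valuation K Γ) (a b : K) (ha : a ≠ 0) (hb : b ≠ 0) (m n : ℕ) :
    ∃ d : K, ∀ β γ : Γ, β ≠ 0 → γ ≠ 0 → (u d ≤ β ↔ u d ≤ γ) → (β ≤ u d ↔ γ ≤ u d) →
      (u a * β ^ m ≤ u b * β ^ n ↔ u a * γ ^ m ≤ u b * γ ^ n) := by
  have hua : 0 < u a := zero_lt_iff.mpr ((Valuation.ne_zero_iff u).mpr ha)
  have hub : 0 < u b := zero_lt_iff.mpr ((Valuation.ne_zero_iff u).mpr hb)
  rcases lt_trichotomy m n with h | h | h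
  · obtain ⟨k, rfl⟩ := Nat.exists_eq_add_of_lt h
    obtain ⟨d, hd⟩ := IsAlgClosed.exists_pow_nat_eq (a / b) (n := k + 1) (by omega)
    refine ⟨d, fun β γ hβ hγ h1 _ => ?_⟩
    have hd' : u a = u b * u d ^ (k + 1) := by
      rw [← map_pow, hd, map_div₀, mul_div_cancel₀ _ hub.ne']
    have key : ∀ β : Γ, β ≠ 0 → (u a * β ^ m ≤ u b * β ^ (m + k + 1) ↔ u d ≤ β) := by
      intro β hβ
      have : 0 < β ^ m := pow_pos (zero_lt_iff.mpr hβ) _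
      rw [hd', show u b * β ^ (m + k + 1) = u b * β ^ (k + 1) * β ^ m by
          rw [mul_assoc, ← pow_add]; congr 2; omega,
        mul_le_mul_iff_left₀ this, mul_le_mul_iff_right₀ hub,
        pow_le_pow_iff_left₀ zero_le zero_le (by omega)]
    rw [key β hβ, key γ hγ, h1]
  · subst h
    refine ⟨0, fun β γ hβ hγ _ _ => ?_⟩
    rw [mul_le_mul_iff_left₀ (pow_pos (zero_lt_iff.mpr hβ) _),
      mul_le_mul_iff_left₀ (pow_pos (zero_lt_iff.mpr hγ) _)]
  · obtain ⟨k, rfl⟩ := Nat.exists_eq_add_of_lt h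
    obtain ⟨d, hd⟩ := IsAlgClosed.exists_pow_nat_eq (b / a) (n := k + 1) (by omega)
    refine ⟨d, fun β γ hβ hγ _ h1 => ?_⟩
    have hd' : u b = u a * u d ^ (k + 1) := by
      rw [← map_pow, hd, map_div₀, mul_div_cancel₀ _ hua.ne']
    have key : ∀ β : Γ, β ≠ 0 → (u a * β ^ (n + k + 1) ≤ u b * β ^ n ↔ β ≤ u d) := by
      intro β hβ
      have : 0 < β ^ n := pow_pos (zero_lt_iff.mpr hβ) _
      rw [hd', show u a * β ^ (n + k + 1) = u a * β ^ (k + 1) * β ^ n by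
          rw [mul_assoc, ← pow_add]; congr 2; omega,
        mul_le_mul_iff_left₀ this, mul_le_mul_iff_right₀ hua,
        pow_le_pow_iff_left₀ zero_le zero_le (by omega)]
    rw [key β hβ, key γ hγ, h1]

lemma ec_one_var {K F Γ : Type*} [Field K] [IsAlgClosed K] [Field F] [Algebra K F]
    [LinearOrderedCommGroupWithZero Γ] (w : Valuation F Γ)
    (hu : ∃ p : K, p ≠ 0 ∧ w (algebraMap K F p) < 1) (t : F) (ht : Transcendental K t)
    (G : Finset K[X]) (hG : ∀ g ∈ G, g ≠ 0) :
    ∃ a : K, (∀ g ∈ G, eval a g ≠ 0) ∧ ∀ g ∈ G, ∀ h ∈ G,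
      (w (aeval t g) ≤ w (aeval t h) ↔
        w (algebraMap K F (eval a g)) ≤ w (algebraMap K F (eval a h))) := by
  classical
  let u : Valuation K Γ := w.comap (algebraMap K F)
  have hu' : ∀ a, w (algebraMap K F a) = u a := fun _ => rfl
  let Cs : Finset K := insert 0 (G.biUnion fun g => g.roots.toFinset)
  obtain ⟨c, hc, hcmin⟩ := Finset.exists_min_image Cs (fun c => w (t - algebraMap K F c))
    ⟨0, Finset.mem_insert_self _ _⟩
  set y := t - algebraMap K F c with hy
  have hy0 : y ≠ 0 := by
    intro h
    exact ht ⟨X - C c, X_sub_C_ne_zero c, by simpa using h⟩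
  let β := w y
  have hβ : β ≠ 0 := (Valuation.ne_zero_iff w).mpr hy0
  have hroot : ∀ r ∈ Cs, (u (r - c) ≤ β → w (t - algebraMap K F r) = β) ∧
      (β < u (r - c) → w (t - algebraMap K F r) = u (r - c)) := by
    intro r hr
    have h1 : t - algebraMap K F r = y - algebraMap K F (r - c) := by
      rw [hy, map_sub]; ring
    refine ⟨fun h => le_antisymm ?_ (hcmin r hr), fun h => ?_⟩
    · rw [h1]
      exact (Valuation.map_sub _ _ _).trans (max_le le_rfl h)
    · rw [h1]
      exact Valuation.map_sub_eq_of_lt_right _ h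
  -- good elements
  let Good : K → Prop := fun b => b ≠ 0 ∧ ∀ r ∈ Cs, (u (r - c) ≤ β → u (c + b - r) = u b) ∧
      (β < u (r - c) → u (c + b - r) = u (r - c))
  have hpoly : ∀ g ∈ G, ∃ (l : K) (m : ℕ), l ≠ 0 ∧ w (aeval t g) = u l * β ^ m ∧
      ∀ b, Good b → u (eval (c + b) g) = u l * u b ^ m := by
    intro g hg
    have hroots : ∀ r ∈ g.roots, r ∈ Cs := fun r hr =>
      Finset.mem_insert_of_mem (Finset.mem_biUnion.mpr ⟨g, hg, Multiset.mem_toFinset.mpr hr⟩)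
    have hsplit : g = C g.leadingCoeff * (g.roots.map fun r => X - C r).prod :=
      (IsAlgClosed.splits g).eq_prod_roots
    have hind : ∀ M : Multiset K, (∀ r ∈ M, r ∈ Cs) → ∃ (l : K) (m : ℕ), l ≠ 0 ∧
        w (aeval t (M.map fun r => X - C r).prod) = u l * β ^ m ∧
        ∀ b, Good b → u (eval (c + b) (M.map fun r => X - C r).prod) = u l * u b ^ m := by
      intro M
      induction M using Multiset.induction_on with
      | empty => intro _; exact ⟨1, 0, one_ne_zero, by simp, by simp⟩
      | cons r M ih =>
        intro hM
        obtain ⟨l, m, hl, h1, h2⟩ := ih fun s hs => hM s (Multiset.mem_cons_of_mem hs)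
        have hr := hM r (Multiset.mem_cons_self _ _)
        rcases le_or_gt (u (r - c)) β with h | h
        · refine ⟨l, m + 1, hl, ?_, fun b hb => ?_⟩
          · rw [Multiset.map_cons, Multiset.prod_cons, map_mul, map_mul, h1, map_sub, aeval_X,
              aeval_C, (hroot r hr).1 h, pow_succ, mul_comm β, mul_assoc]
          · rw [Multiset.map_cons, Multiset.prod_cons, eval_mul, map_mul, h2 b hb, eval_sub, eval_X,
              eval_C, (hb.2 r hr).1 h, pow_succ, mul_comm (u b), mul_assoc]
        · refine ⟨(r - c) * l, m, mul_ne_zero ?_ hl, ?_, fun b hb => ?_⟩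
          · intro h0
            rw [h0, map_zero] at h
            exact absurd h (not_lt.mpr zero_le)
          · rw [Multiset.map_cons, Multiset.prod_cons, map_mul, map_mul, h1, map_sub, aeval_X,
              aeval_C, (hroot r hr).2 h, map_mul u, mul_assoc]
          · rw [Multiset.map_cons, Multiset.prod_cons, eval_mul, map_mul, h2 b hb, eval_sub, eval_X,
              eval_C, (hb.2 r hr).2 h, map_mul u, mul_assoc]
    obtain ⟨l, m, hl, h1, h2⟩ := hind g.roots hroots
    refine ⟨g.leadingCoeff * l, m, mul_ne_zero (leadingCoeff_ne_zero.mpr (hG g hg)) hl, ?_, ?_⟩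
    · conv_lhs => rw [hsplit]
      rw [map_mul, map_mul, h1, aeval_C, hu', map_mul u, mul_assoc]
    · intro b hb
      conv_lhs => rw [hsplit]
      rw [eval_mul, map_mul, h2 b hb, eval_C, map_mul u, mul_assoc]
  choose! l m hl hw hub using hpoly
  have hcmp : ∀ g ∈ G, ∀ h ∈ G, ∃ d : K, ∀ β γ : Γ, β ≠ 0 → γ ≠ 0 → (u d ≤ β ↔ u d ≤ γ) →
      (β ≤ u d ↔ γ ≤ u d) →
      (u (l g) * β ^ (m g) ≤ u (l h) * β ^ (m h) ↔ u (l g) * γ ^ (m g) ≤ u (l h) * γ ^ (m h)) :=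
    fun g hg h hh => ec_cmp u _ _ (hl g hg) (hl h hh) _ _
  choose! d hd using hcmp
  obtain ⟨b, hb0, hb⟩ := ec_cut u hu β hβ
    ((Cs.image fun r => r - c) ∪ (G ×ˢ G).image fun p => d p.1 p.2)
  have hub0 : u b ≠ 0 := (Valuation.ne_zero_iff u).mpr hb0
  have hgood : Good b := by
    refine ⟨hb0, fun r hr => ?_⟩
    obtain ⟨h1, h2, h3⟩ := hb (r - c)
      (Finset.mem_union_left _ (Finset.mem_image.mpr ⟨r, hr, rfl⟩))
    rw [show c + b - r = b - (r - c) by ring]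
    refine ⟨h3, fun h => ?_⟩
    exact Valuation.map_sub_eq_of_lt_right _ (not_le.mp (mt h1.mpr (not_le.mpr h)))
  refine ⟨c + b, fun g hg h0 => ?_, fun g hg h hh => ?_⟩
  · have := hub g hg b hgood
    rw [h0, map_zero] at this
    exact mul_ne_zero ((Valuation.ne_zero_iff u).mpr (hl g hg)) (pow_ne_zero _ hub0) this.symm
  · rw [hw g hg, hw h hh, hu', hu', hub g hg b hgood, hub h hh b hgood]
    obtain ⟨h1, h2, -⟩ := hb (d g h) (Finset.mem_union_right _
      (Finset.mem_image.mpr ⟨(g, h), Finset.mem_product.mpr ⟨hg, hh⟩, rfl⟩))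
    exact hd g hg h hh β (u b) hβ hub0 h1 h2

lemma ec_embed {E Ω M : Type*} [Field E] [Field Ω] [Field M] [Algebra E Ω] [Algebra E M]
    [IsAlgClosed Ω] [IsAlgClosed M] (OE : ValuationSubring E) (OΩ : ValuationSubring Ω)
    (OM : ValuationSubring M) (hΩ : ∀ e, e ∈ OE ↔ algebraMap E Ω e ∈ OΩ)
    (hM : ∀ e, e ∈ OE ↔ algebraMap E M e ∈ OM) {n : ℕ} (x : Fin n → Ω)
    (hx : ∀ i, IsAlgebraic E (x i)) :
    ∃ (N : IntermediateField E Ω) (θ : N →ₐ[E] M), (∀ i, x i ∈ N) ∧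
      ∀ z : N, (z : Ω) ∈ OΩ ↔ θ z ∈ OM := by
  let f : E[X] := ∏ i, minpoly E (x i)
  have hf0 : f ≠ 0 := Finset.prod_ne_zero_iff.mpr fun i _ => minpoly.ne_zero (hx i).isIntegral
  let N : IntermediateField E Ω := IntermediateField.adjoin E (f.rootSet Ω)
  have hN : f.IsSplittingField E N :=
    IntermediateField.adjoin_rootSet_isSplittingField (IsAlgClosed.splits _)
  have : Normal E N := Normal.of_isSplittingField f
  have : FiniteDimensional E N := IsSplittingField.finiteDimensional N f
  have hxN : ∀ i, x i ∈ N := by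
    intro i
    apply IntermediateField.subset_adjoin
    rw [mem_rootSet]
    refine ⟨hf0, ?_⟩
    simp only [f, map_prod]
    exact Finset.prod_eq_zero (Finset.mem_univ i) (minpoly.aeval _ _)
  let j : N →ₐ[E] M := IsAlgClosed.lift
  obtain ⟨σ, hσ⟩ := ec_conj (N := N) OE (OΩ.comap (algebraMap N Ω)) (OM.comap (j : N →+* M))
    (fun e => by
      rw [hΩ, ValuationSubring.mem_comap, ← IsScalarTower.algebraMap_apply])
    (fun e => by
      rw [hM, ValuationSubring.mem_comap]
      simp)
  exact ⟨N, j.comp (σ : N →ₐ[E] N), hxN, fun z => hσ z⟩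

section Ultra

open Filter

variable {ι K : Type*} [Field K] (φ : Ultrafilter ι)

/-- the valuation ring of the ultrapower -/
def ecO (O : ValuationSubring K) : ValuationSubring (Germ (φ : Filter ι) K) where
  carrier := {z | z.LiftPred (· ∈ O)}
  mul_mem' {a b} := Germ.inductionOn₂ a b fun f g hf hg => by
    change ∀ᶠ i in (φ : Filter ι), f i ∈ O at hf
    change ∀ᶠ i in (φ : Filter ι), g i ∈ O at hg
    change ∀ᶠ i in (φ : Filter ι), f i * g i ∈ O
    filter_upwards [hf, hg] with i h1 h2 using mul_mem h1 h2
  one_mem' := Eventually.of_forall fun _ => one_mem O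
  add_mem' {a b} := Germ.inductionOn₂ a b fun f g hf hg => by
    change ∀ᶠ i in (φ : Filter ι), f i ∈ O at hf
    change ∀ᶠ i in (φ : Filter ι), g i ∈ O at hg
    change ∀ᶠ i in (φ : Filter ι), f i + g i ∈ O
    filter_upwards [hf, hg] with i h1 h2 using add_mem h1 h2
  zero_mem' := Eventually.of_forall fun _ => zero_mem O
  neg_mem' {a} := Germ.inductionOn a fun f hf => by
    change ∀ᶠ i in (φ : Filter ι), f i ∈ O at hf
    change ∀ᶠ i in (φ : Filter ι), - f i ∈ O
    filter_upwards [hf] with i h1 using neg_mem h1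
  mem_or_inv_mem' a := Germ.inductionOn a fun f => by
    change (∀ᶠ i in (φ : Filter ι), f i ∈ O) ∨ (∀ᶠ i in (φ : Filter ι), (f i)⁻¹ ∈ O)
    rw [← Ultrafilter.eventually_or]
    exact Eventually.of_forall fun i => O.mem_or_inv_mem (f i)

lemma ecO_coe (O : ValuationSubring K) (f : ι → K) :
    (f : Germ (φ : Filter ι) K) ∈ ecO φ O ↔ ∀ᶠ i in (φ : Filter ι), f i ∈ O := Iff.rfl

lemma ec_ultra_algClosed [IsAlgClosed K] : IsAlgClosed (Germ (φ : Filter ι) K) := by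
  refine IsAlgClosed.of_exists_root _ fun p hp hirr => ?_
  have hdeg : 0 < p.natDegree := hirr.natDegree_pos
  have hc : ∀ k, ∃ f : ι → K, (f : Germ (φ : Filter ι) K) = p.coeff k := fun k =>
    Germ.inductionOn (p.coeff k) fun f => ⟨f, rfl⟩
  choose c hc using hc
  have hroot : ∀ i, ∃ r : K, r ^ p.natDegree + ∑ k ∈ Finset.range p.natDegree, c k i * r ^ k = 0 := by
    intro i
    let q : K[X] := ∑ k ∈ Finset.range p.natDegree, C (c k i) * X ^ k
    have hq : q.degree < p.natDegree := by
      refine (degree_sum_le _ _).trans_lt ?_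
      rw [Finset.sup_lt_iff (WithBot.bot_lt_coe _)]
      intro k hk
      exact (degree_C_mul_X_pow_le _ _).trans_lt (by exact_mod_cast Finset.mem_range.mp hk)
    obtain ⟨r, hr⟩ := IsAlgClosed.exists_root (X ^ p.natDegree + q) (by
      rw [degree_add_eq_left_of_degree_lt (by rwa [degree_X_pow]), degree_X_pow]
      exact_mod_cast hdeg.ne')
    refine ⟨r, ?_⟩
    have : eval r (X ^ p.natDegree + q) = 0 := hr
    simpa [q, eval_finsetSum] using this
  choose r hr using hroot
  refine ⟨(r : Germ (φ : Filter ι) K), ?_⟩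
  rw [eval_eq_sum_range, Finset.sum_range_succ, hp.coeff_natDegree, one_mul]
  have h1 : Germ.coeRingHom (φ : Filter ι) (r ^ p.natDegree +
      ∑ k ∈ Finset.range p.natDegree, c k * r ^ k) = 0 := by
    have : r ^ p.natDegree + ∑ k ∈ Finset.range p.natDegree, c k * r ^ k = 0 := by
      funext i
      simpa using hr i
    rw [this, map_zero]
  rw [map_add, map_sum, add_comm] at h1
  convert h1 using 2
  · refine Finset.sum_congr rfl fun k _ => ?_
    rw [map_mul, map_pow, ← hc]
    rfl
  · rw [map_pow]
    rfl

end Ultra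

lemma ec_vle_iff {F : Type*} [Field F] (O : ValuationSubring F) (a b : F) :
    vle O a b ↔ (a = 0 ∧ b = 0) ∨ (a ≠ 0 ∧ b / a ∈ O) := by
  constructor
  · rintro ⟨c, hc, rfl⟩
    by_cases ha : a = 0
    · left; simp [ha]
    · right; exact ⟨ha, by rwa [mul_div_cancel_left₀ _ ha]⟩
  · rintro (⟨rfl, rfl⟩ | ⟨ha, h⟩)
    · exact ⟨1, one_mem _, by simp⟩
    · exact ⟨b / a, h, (mul_div_cancel₀ _ ha).symm⟩

lemma ec_vle_map {F M : Type*} [Field F] [Field M] (θ : F →+* M) (O : ValuationSubring F)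
    (O' : ValuationSubring M) (h : ∀ z, z ∈ O ↔ θ z ∈ O') (a b : F) :
    vle O a b ↔ vle O' (θ a) (θ b) := by
  rw [ec_vle_iff, ec_vle_iff, h, map_div₀, map_eq_zero, map_eq_zero, ne_eq, ne_eq, map_eq_zero]

lemma ec_vle_germ {ι K : Type*} [Field K] (φ : Ultrafilter ι) (O : ValuationSubring K)
    (f g : ι → K) :
    vle (ecO φ O) (f : Filter.Germ (φ : Filter ι) K) (g : Filter.Germ (φ : Filter ι) K) ↔
      ∀ᶠ i in (φ : Filter ι), vle O (f i) (g i) := by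
  have h0 : ∀ f : ι → K, (f : Filter.Germ (φ : Filter ι) K) = 0 ↔
      ∀ᶠ i in (φ : Filter ι), f i = 0 := fun f => Filter.Germ.coe_eq
  simp only [ec_vle_iff, Ultrafilter.eventually_or, Filter.eventually_and, ne_eq,
    Ultrafilter.eventually_not, h0, ← Filter.Germ.coe_div, ecO_coe, Pi.div_apply]

lemma ec_vle_val {F : Type*} [Field F] (O : ValuationSubring F) (a b : F) :
    vle O a b ↔ O.valuation b ≤ O.valuation a := by
  rw [ValuationSubring.valuation_le_iff]
  constructor
  · rintro ⟨c, hc, rfl⟩; exact ⟨⟨c, hc⟩, mul_comm _ _⟩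
  · rintro ⟨c, rfl⟩; exact ⟨c, c.2, mul_comm _ _⟩

lemma ec_transfer {K E Ω ι : Type*} [Field K] [Field E] [Field Ω] [IsAlgClosed K] [IsAlgClosed Ω]
    [Algebra K Ω] (φ : Ultrafilter ι) (iE : K →+* E) (jΩ : E →+* Ω)
    (jM : E →+* Filter.Germ (φ : Filter ι) K)
    (hc : ∀ c : K, jΩ (iE c) = algebraMap K Ω c)
    (hcM : ∀ c : K, jM (iE c) = ((fun _ => c : ι → K) : Filter.Germ (φ : Filter ι) K))
    (OK : ValuationSubring K) (OΩ : ValuationSubring Ω)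
    (hE : ∀ e, jΩ e ∈ OΩ ↔ jM e ∈ ecO φ OK) {n : ℕ} (x : Fin n → Ω)
    (hx : ∀ i, ∃ p : E[X], p ≠ 0 ∧ eval₂ jΩ (x i) p = 0)
    (A : Finset (MvPolynomial (Fin n) K)) :
    ∃ y : Fin n → K, ∀ P ∈ A, ∀ Q ∈ A,
      (vle OΩ (MvPolynomial.aeval x P) (MvPolynomial.aeval x Q) ↔
        vle OK (MvPolynomial.aeval y P) (MvPolynomial.aeval y Q)) := by
  have := ec_ultra_algClosed (K := K) φ
  let := jΩ.toAlgebra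
  let := jM.toAlgebra
  obtain ⟨N, θ, hN, hθ⟩ := ec_embed (OΩ.comap (algebraMap E Ω)) OΩ (ecO φ OK)
    (fun e => Iff.rfl) hE x hx
  have hrep : ∀ i, ∃ f : ι → K, (f : Filter.Germ (φ : Filter ι) K) = θ ⟨x i, hN i⟩ := fun i =>
    Filter.Germ.inductionOn (θ ⟨x i, hN i⟩) fun f => ⟨f, rfl⟩
  choose f hf using hrep
  -- the polynomial evaluated in `N`
  let ev : MvPolynomial (Fin n) K →+* N :=
    MvPolynomial.eval₂Hom ((algebraMap E N).comp iE) fun i => ⟨x i, hN i⟩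
  have h1 : ∀ P, algebraMap N Ω (ev P) = MvPolynomial.aeval x P := by
    intro P
    have : (algebraMap N Ω).comp ev = (MvPolynomial.aeval (R := K) x : _ →+* Ω) := by
      apply MvPolynomial.ringHom_ext
      · intro c
        simp only [ev, RingHom.comp_apply, MvPolynomial.eval₂Hom_C, RingHom.coe_coe,
          MvPolynomial.aeval_C]
        rw [← hc]
        rfl
      · intro i
        simp [ev]
    exact RingHom.congr_fun this P
  let evf : MvPolynomial (Fin n) K →+* (ι → K) :=
    RingHom.pi fun j => (MvPolynomial.aeval (fun i => f i j) : MvPolynomial (Fin n) K →ₐ[K] K).toRingHom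
  have h2 : ∀ P, θ (ev P) =
      ((fun j => MvPolynomial.aeval (fun i => f i j) P : ι → K) : Filter.Germ (φ : Filter ι) K) := by
    intro P
    have : (θ : N →+* _).comp ev = (Filter.Germ.coeRingHom (φ : Filter ι)).comp evf := by
      apply MvPolynomial.ringHom_ext
      · intro c
        simp only [ev, RingHom.comp_apply, MvPolynomial.eval₂Hom_C, RingHom.coe_coe]
        rw [AlgHom.commutes]
        refine (hcM c).trans ?_
        congr 1
        funext j
        exact (MvPolynomial.aeval_C _ c).symm
      · intro i
        simp only [ev, RingHom.comp_apply, MvPolynomial.eval₂Hom_X', RingHom.coe_coe]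
        rw [← hf]
        congr 1
        funext j
        exact (MvPolynomial.aeval_X (R := K) (fun i => f i j) i).symm
    exact RingHom.congr_fun this P
  have h3 : ∀ P Q : MvPolynomial (Fin n) K, ∀ᶠ j : ι in (φ : Filter ι),
      (vle OΩ (MvPolynomial.aeval x P) (MvPolynomial.aeval x Q) ↔
        vle OK (MvPolynomial.aeval (fun i => f i j) P) (MvPolynomial.aeval (fun i => f i j) Q)) := by
    intro P Q
    have h4 := (ec_vle_map (algebraMap N Ω) (OΩ.comap (algebraMap N Ω)) OΩ (fun z => Iff.rfl)
      (ev P) (ev Q)).symm.trans (ec_vle_map θ.toRingHom (OΩ.comap (algebraMap N Ω))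
        (ecO φ OK) hθ (ev P) (ev Q))
    rw [h1, h1, AlgHom.toRingHom_eq_coe, RingHom.coe_coe, h2, h2, ec_vle_germ] at h4
    by_cases h5 : vle OΩ (MvPolynomial.aeval x P) (MvPolynomial.aeval x Q)
    · filter_upwards [h4.1 h5] with j hj using iff_of_true h5 hj
    · have h6 := mt h4.2 h5
      rw [← Ultrafilter.eventually_not] at h6
      filter_upwards [h6] with j hj using iff_of_false h5 hj
  have h7 : ∀ᶠ j : ι in (φ : Filter ι), ∀ P ∈ A, ∀ Q ∈ A,
      (vle OΩ (MvPolynomial.aeval x P) (MvPolynomial.aeval x Q) ↔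
        vle OK (MvPolynomial.aeval (fun i => f i j) P) (MvPolynomial.aeval (fun i => f i j) Q)) :=
    (Filter.eventually_all_finset A).2 fun P _ => (Filter.eventually_all_finset A).2 fun Q _ => h3 P Q
  obtain ⟨j, hj⟩ := h7.exists
  exact ⟨_, hj⟩

lemma ec_nontriv {K F : Type*} [Field K] [Field F] [Algebra K F] (OK : ValuationSubring K)
    (OF : ValuationSubring F) (hnontriv : OK ≠ ⊤)
    (hext : ∀ x : K, x ∈ OK ↔ algebraMap K F x ∈ OF) :
    ∃ p : K, p ≠ 0 ∧ OF.valuation (algebraMap K F p) < 1 := by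
  have : ∃ z, z ∉ OK := by
    by_contra! h
    exact hnontriv (eq_top_iff.2 fun z _ => h z)
  obtain ⟨z, hz⟩ := this
  have hz0 : z ≠ 0 := fun h => hz (h ▸ zero_mem _)
  refine ⟨z⁻¹, inv_ne_zero hz0, ?_⟩
  rw [← ec_nonunits_iff (algebraMap K F) OK OF hext, ← ValuationSubring.mem_nonunits_iff,
    ValuationSubring.mem_nonunits_iff_or, inv_inv]
  exact Or.inr hz

lemma ec_step {K Ω : Type*} [Field K] [Field Ω] [IsAlgClosed K] [IsAlgClosed Ω]
    [Algebra K Ω] (OK : ValuationSubring K) (OΩ : ValuationSubring Ω) (hnontriv : OK ≠ ⊤)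
    (hext : ∀ x : K, x ∈ OK ↔ algebraMap K Ω x ∈ OΩ) (t : Ω) (ht : Transcendental K t)
    {n : ℕ} (x : Fin n → Ω) (hx : ∀ i, IsAlgebraic (IntermediateField.adjoin K {t}) (x i))
    (A : Finset (MvPolynomial (Fin n) K)) :
    ∃ y : Fin n → K, ∀ P ∈ A, ∀ Q ∈ A,
      (vle OΩ (MvPolynomial.aeval x P) (MvPolynomial.aeval x Q) ↔
        vle OK (MvPolynomial.aeval y P) (MvPolynomial.aeval y Q)) := by
  classical
  let ι := Finset {g : K[X] // g ≠ 0}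
  have hone := fun G : ι => ec_one_var OΩ.valuation (ec_nontriv OK OΩ hnontriv hext) t ht
    (G.map (Function.Embedding.subtype _)) (by
      intro g hg
      obtain ⟨g', -, rfl⟩ := Finset.mem_map.1 hg
      exact g'.2)
  choose a ha0 ha using hone
  let φ : Ultrafilter ι := Ultrafilter.of Filter.atTop
  have hφ : ∀ g : K[X], g ≠ 0 →
      ∀ᶠ G : ι in (φ : Filter ι), g ∈ G.map (Function.Embedding.subtype (· ≠ 0)) := by
    intro g hg
    apply Ultrafilter.of_le
    filter_upwards [Filter.eventually_ge_atTop ({⟨g, hg⟩} : ι)] with G hG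
    exact Finset.mem_map.2 ⟨⟨g, hg⟩, hG (Finset.mem_singleton_self _), rfl⟩
  let M := Filter.Germ (φ : Filter ι) K
  let evM : K[X] →+* M := (Filter.Germ.coeRingHom (φ : Filter ι)).comp
    (RingHom.pi fun G => evalRingHom (a G))
  have hevM : ∀ g, evM g = ((fun G => eval (a G) g : ι → K) : Filter.Germ (φ : Filter ι) K) :=
    fun g => rfl
  have hMinj : Function.Injective evM := by
    rw [injective_iff_map_eq_zero]
    intro g hg
    by_contra hg0
    have h1 : ∀ᶠ G in (φ : Filter ι), eval (a G) g = 0 := Filter.Germ.coe_eq.1 hg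
    obtain ⟨G, h2, h3⟩ := (h1.and (hφ g hg0)).exists
    exact ha0 G g h3 h2
  have hΩinj : Function.Injective (aeval t : K[X] →ₐ[K] Ω) :=
    transcendental_iff_injective.1 ht
  let E := FractionRing K[X]
  let jΩ : E →+* Ω := IsFractionRing.lift (A := K[X]) (g := (aeval t : K[X] →ₐ[K] Ω).toRingHom) hΩinj
  let jM : E →+* M := IsFractionRing.lift (A := K[X]) hMinj
  have hjΩ : ∀ g, jΩ (algebraMap K[X] E g) = aeval t g := fun g =>
    IsFractionRing.lift_algebraMap (A := K[X])
      (g := (aeval t : K[X] →ₐ[K] Ω).toRingHom) hΩinj g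
  have hjM : ∀ g, jM (algebraMap K[X] E g) = evM g := fun g =>
    IsFractionRing.lift_algebraMap (A := K[X]) hMinj g
  refine ec_transfer φ ((algebraMap K[X] E).comp C) jΩ jM (fun c => ?_) (fun c => ?_) OK OΩ
    (fun e => ?_) x (fun i => ?_) A
  · simp [hjΩ]
  · rw [RingHom.comp_apply, hjM, hevM]
    simp
  · obtain ⟨g, h, hh, rfl⟩ := IsFractionRing.div_surjective (A := K[X]) e
    have hh0 : h ≠ 0 := nonZeroDivisors.ne_zero hh
    by_cases hg0 : g = 0
    · simp [hg0]
    rw [map_div₀, map_div₀, hjΩ, hjΩ, hjM, hjM]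
    have e1 : aeval t h ≠ 0 := fun h0 => hh0 (hΩinj (by rw [h0, map_zero]))
    have e2 : evM h ≠ 0 := fun h0 => hh0 (hMinj (by rw [h0, map_zero]))
    have e3 := ec_vle_iff OΩ (aeval t h) (aeval t g)
    have e4 := ec_vle_iff (ecO φ OK) (evM h) (evM g)
    simp only [e1, e2, false_and, false_or, ne_eq, not_false_eq_true, true_and] at e3 e4
    rw [← e3, ← e4, hevM, hevM, ec_vle_germ]
    have e5 : ∀ᶠ G : ι in (φ : Filter ι), (vle OΩ (aeval t h) (aeval t g) ↔
        vle OK (eval (a G) h) (eval (a G) g)) := by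
      filter_upwards [hφ g hg0, hφ h hh0] with G hG1 hG2
      rw [ec_vle_val, ha G g hG1 h hG2, ← ec_vle_val, ← ec_vle_map (algebraMap K Ω) OK OΩ hext]
    rw [← Filter.eventually_congr e5, Filter.eventually_const]
  · obtain ⟨p, hp0, hp⟩ := hx i
    have hl : p.map (algebraMap (IntermediateField.adjoin K {t}) Ω) ∈ lifts jΩ := by
      rw [lifts_iff_coeff_lifts]
      intro m
      rw [coeff_map]
      obtain ⟨r, s, hrs⟩ := (IntermediateField.mem_adjoin_simple_iff K _).1 (p.coeff m).2
      refine ⟨algebraMap K[X] E r / algebraMap K[X] E s, ?_⟩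
      rw [map_div₀, hjΩ, hjΩ, ← hrs]
      rfl
    obtain ⟨q, hq⟩ := hl
    rw [coe_mapRingHom] at hq
    refine ⟨q, ?_, ?_⟩
    · rintro rfl
      rw [Polynomial.map_zero] at hq
      exact hp0 ((Polynomial.map_eq_zero _).1 hq.symm)
    · rw [← eval_map, hq, eval_map]
      exact hp

lemma ec_aeval1 {A B C : Type*} [Field A] [Field B] [Field C] [Algebra A C] (σ : A →+* B)
    (θ : B →+* C) (h : ∀ a, θ (σ a) = algebraMap A C a) {n : ℕ} (y : Fin n → B)
    (P : MvPolynomial (Fin n) A) :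
    θ (MvPolynomial.aeval y (MvPolynomial.map σ P)) =
      MvPolynomial.aeval (fun i => θ (y i)) P := by
  induction P using MvPolynomial.induction_on with
  | C a => simp [h]
  | add p q hp hq => simp only [map_add, hp, hq]
  | mul_X p i hp => simp only [map_mul, hp, MvPolynomial.map_X, MvPolynomial.aeval_X]

lemma ec_aeval2 {A B C : Type*} [Field A] [Field B] [Field C] [Algebra A C] [Algebra B C]
    (σ : A →+* B) (h : ∀ a, algebraMap B C (σ a) = algebraMap A C a) {n : ℕ} (x : Fin n → C)
    (P : MvPolynomial (Fin n) A) :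
    MvPolynomial.aeval x (MvPolynomial.map σ P) = MvPolynomial.aeval x P := by
  induction P using MvPolynomial.induction_on with
  | C a => simp [h]
  | add p q hp hq => simp only [map_add, hp, hq]
  | mul_X p i hp => simp only [map_mul, hp, MvPolynomial.map_X, MvPolynomial.aeval_X]

lemma ec_aeval3 {A B : Type*} [Field A] [Field B]
    (σ : A →+* B) {n : ℕ} (y : Fin n → A) (P : MvPolynomial (Fin n) A) :
    σ (MvPolynomial.aeval y P) =
      MvPolynomial.aeval (fun i => σ (y i)) (MvPolynomial.map σ P) := by
  induction P using MvPolynomial.induction_on with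
  | C a => simp
  | add p q hp hq => simp only [map_add, hp, hq]
  | mul_X p i hp => simp only [map_mul, hp, MvPolynomial.map_X, MvPolynomial.aeval_X]

lemma ec_chain {Ω : Type*} [Field Ω] [IsAlgClosed Ω] (OΩ : ValuationSubring Ω) {n : ℕ}
    (x : Fin n → Ω) (S : Finset Ω) : ∀ (L : Subfield Ω), IsAlgClosed L →
      OΩ.comap L.subtype ≠ ⊤ → (∀ i, x i ∈ L ∨ x i ∈ S) →
      ∀ A : Finset (MvPolynomial (Fin n) L), ∃ y : Fin n → L, ∀ P ∈ A, ∀ Q ∈ A,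
      (vle OΩ (MvPolynomial.aeval x P) (MvPolynomial.aeval x Q) ↔
        vle (OΩ.comap L.subtype) (MvPolynomial.aeval y P) (MvPolynomial.aeval y Q)) := by
  classical
  induction S using Finset.induction_on with
  | empty =>
    intro L hL hnt hx A
    have hx' : ∀ i, x i ∈ L := fun i => (hx i).resolve_right (Finset.notMem_empty _)
    refine ⟨fun i => ⟨x i, hx' i⟩, fun P _ Q _ => ?_⟩
    have h : ∀ P : MvPolynomial (Fin n) L, L.subtype (MvPolynomial.aeval (fun i => ⟨x i, hx' i⟩) P) =
        MvPolynomial.aeval x P := fun P => by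
      have := ec_aeval1 (RingHom.id L) L.subtype (fun _ => rfl) (fun i => ⟨x i, hx' i⟩) P
      rwa [MvPolynomial.map_id] at this
    rw [ec_vle_map L.subtype (OΩ.comap L.subtype) OΩ (fun z => Iff.rfl), h, h]
  | insert t S _ ih =>
    intro L hL hnt hx A
    by_cases ht : IsAlgebraic L t
    · refine ih L hL hnt (fun i => ?_) A
      rcases hx i with h | h
      · exact Or.inl h
      rcases Finset.mem_insert.1 h with h | h
      · left
        have h1 : t ∈ algebraicClosure L Ω := mem_algebraicClosure_iff.2 ht
        rw [(IsAlgClosed.algebraicClosure_eq_bot_iff L Ω).2 hL, IntermediateField.mem_bot] at h1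
        obtain ⟨z, hz⟩ := h1
        rw [h, ← hz]
        exact z.2
      · exact Or.inr h
    · let E := IntermediateField.adjoin L {t}
      let L' : Subfield Ω := (algebraicClosure E Ω).toSubfield
      have hL' : IsAlgClosed L' := (algebraicClosure.isAlgClosure E Ω).isAlgClosed
      have hmem : ∀ z, z ∈ L' ↔ IsAlgebraic E z := fun z => mem_algebraicClosure_iff
      have hEL : ∀ z, z ∈ E → z ∈ L' := fun z hz =>
        (hmem z).2 (isAlgebraic_algebraMap (⟨z, hz⟩ : E))
      have hLL : L ≤ L' := fun z hz => hEL z (E.algebraMap_mem ⟨z, hz⟩)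
      have htL : t ∈ L' := hEL t (IntermediateField.mem_adjoin_simple_self L t)
      have hnt' : OΩ.comap L'.subtype ≠ ⊤ := by
        intro h
        apply hnt
        rw [eq_top_iff]
        intro z _
        have : Subfield.inclusion hLL z ∈ OΩ.comap L'.subtype := h ▸ ValuationSubring.mem_top _
        exact this
      let σ := Subfield.inclusion hLL
      obtain ⟨y, hy⟩ := ih L' hL' hnt' (fun i => by
        rcases hx i with h | h
        · exact Or.inl (hLL h)
        rcases Finset.mem_insert.1 h with h | h
        · exact Or.inl (h ▸ htL)
        · exact Or.inr h) (A.image (MvPolynomial.map σ))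
      obtain ⟨y', hy'⟩ := ec_step (OΩ.comap L.subtype) OΩ hnt (fun z => Iff.rfl) t ht
        (fun i => L'.subtype (y i)) (fun i => (hmem _).1 (y i).2) A
      refine ⟨y', fun P hP Q hQ => ?_⟩
      rw [← hy' P hP Q hQ]
      have h1 := hy _ (Finset.mem_image_of_mem _ hP) _ (Finset.mem_image_of_mem _ hQ)
      rw [ec_aeval2 σ (fun _ => rfl), ec_aeval2 σ (fun _ => rfl),
        ec_vle_map L'.subtype (OΩ.comap L'.subtype) OΩ (fun z => Iff.rfl),
        ec_aeval1 σ L'.subtype (fun _ => rfl), ec_aeval1 σ L'.subtype (fun _ => rfl)] at h1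
      exact h1

lemma ec_extend {F Ω : Type*} [Field F] [Field Ω] [Algebra F Ω] (OF : ValuationSubring F) :
    ∃ OΩ : ValuationSubring Ω, ∀ z, z ∈ OF ↔ algebraMap F Ω z ∈ OΩ := by
  obtain ⟨B, hB, hloc⟩ := IsLocalRing.exists_factor_valuationRing
    ((algebraMap F Ω).comp OF.subtype)
  have hin : ∀ z, z ∈ OF → algebraMap F Ω z ∈ B := fun z hz => hB ⟨z, hz⟩
  refine ⟨B, fun z => ⟨hin z, fun hz => ?_⟩⟩
  by_contra hzn
  have hz0 : z ≠ 0 := fun h => hzn (h ▸ zero_mem _)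
  have hzi : z⁻¹ ∈ OF := (OF.mem_or_inv_mem z).resolve_left hzn
  have hu : IsUnit (⟨z⁻¹, hzi⟩ : OF) := by
    apply hloc.map_nonunit
    refine IsUnit.of_mul_eq_one ⟨algebraMap F Ω z, hz⟩ ?_
    apply Subtype.ext
    change algebraMap F Ω z⁻¹ * algebraMap F Ω z = 1
    rw [← map_mul, inv_mul_cancel₀ hz0, map_one]
  obtain ⟨w, hw⟩ := hu.exists_right_inv
  have h1 : z⁻¹ * (w : F) = 1 := congrArg Subtype.val hw
  have h2 : (w : F) = z := by
    field_simp at h1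
    exact h1
  exact hzn (h2 ▸ w.2)

lemma ec_main {K F : Type*} [Field K] [IsAlgClosed K] [Field F] [Algebra K F]
    (OK : ValuationSubring K) (OF : ValuationSubring F) (hnontriv : OK ≠ ⊤)
    (hext : ∀ x : K, x ∈ OK ↔ algebraMap K F x ∈ OF) {n : ℕ} (x : Fin n → F)
    (A : Finset (MvPolynomial (Fin n) K)) :
    ∃ y : Fin n → K, ∀ P ∈ A, ∀ Q ∈ A,
      (vle OF (MvPolynomial.aeval x P) (MvPolynomial.aeval x Q) ↔
        vle OK (MvPolynomial.aeval y P) (MvPolynomial.aeval y Q)) := by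
  classical
  let Ω := AlgebraicClosure F
  obtain ⟨OΩ, hΩ⟩ := ec_extend (Ω := Ω) OF
  let τ : K →+* Ω := (algebraMap F Ω).comp (algebraMap K F)
  let L : Subfield Ω := τ.fieldRange
  let σ : K →+* L := τ.rangeRestrictField
  have hσ : Function.Bijective σ := ⟨σ.injective, τ.rangeRestrictField_bijective.2⟩
  let e : K ≃+* L := RingEquiv.ofBijective σ hσ
  have hO : ∀ z, z ∈ OK ↔ σ z ∈ OΩ.comap L.subtype := fun z => (hext z).trans (hΩ _)
  have hL : IsAlgClosed L := by
    refine IsAlgClosed.of_exists_root _ fun p _ hirr => ?_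
    obtain ⟨z, hz⟩ := IsAlgClosed.exists_root (p.map (e.symm : L →+* K)) (by
      rw [degree_map]
      exact (degree_pos_of_irreducible hirr).ne')
    refine ⟨e z, ?_⟩
    have h2 := congrArg e hz
    rw [eval_map, map_zero] at h2
    have h3 := hom_eval₂ p (e.symm : L →+* K) (e : K →+* L) z
    have h4 : (e : K →+* L).comp (e.symm : L →+* K) = RingHom.id L := by
      ext z
      simp
    rw [h4] at h3
    exact h3.symm.trans h2
  have hnt : OΩ.comap L.subtype ≠ ⊤ := by
    intro h
    apply hnontriv
    rw [eq_top_iff]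
    intro z _
    rw [hO, h]
    exact ValuationSubring.mem_top _
  obtain ⟨y, hy⟩ := ec_chain OΩ (fun i => algebraMap F Ω (x i))
    (Finset.univ.image fun i => algebraMap F Ω (x i)) L hL hnt
    (fun i => Or.inr (Finset.mem_image_of_mem _ (Finset.mem_univ i))) (A.image (MvPolynomial.map σ))
  choose y' hy' using fun i => hσ.2 (y i)
  obtain rfl : (fun i => σ (y' i)) = y := funext hy'
  refine ⟨y', fun P hP Q hQ => ?_⟩
  have h1 := hy _ (Finset.mem_image_of_mem _ hP) _ (Finset.mem_image_of_mem _ hQ)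
  rw [← ec_aeval3, ← ec_aeval3, ← ec_vle_map σ OK _ hO] at h1
  rw [← h1, ec_vle_map (algebraMap F Ω) OF OΩ hΩ]
  have h2 : ∀ P : MvPolynomial (Fin n) K, MvPolynomial.aeval (fun i => algebraMap F Ω (x i))
      (MvPolynomial.map σ P) = algebraMap F Ω (MvPolynomial.aeval x P) := by
    intro P
    rw [ec_aeval2 σ (fun a => IsScalarTower.algebraMap_apply K F Ω a ▸ rfl)]
    exact MvPolynomial.aeval_algebraMap_apply Ω x P
  rw [h2, h2]

lemma ec_vle_zero {F : Type*} [Field F] (O : ValuationSubring F) (b : F) :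
    vle O 0 b ↔ b = 0 := by
  rw [ec_vle_iff]
  simp

/-- In the language of rings with a relation symbol for a valuation, an algebraically closed
field `K` with a nontrivial valuation is existentially closed in every valued extension field
`F`: every existential sentence in this language with parameters from `K` which holds in the
valued field `F` also holds in the valued field `K`. (An existential sentence with parameters
from `K` is equivalent to the solvability of a finite system of polynomial equations,
inequations, valuation divisibilities and negated valuation divisibilities over `K`.) -/
theorem algClosed_valued_existentially_closed_in_extensions
    (K F : Type*) [Field K] [IsAlgClosed K] [Field F] [Algebra K F]
    (OK : ValuationSubring K) (OF : ValuationSubring F)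
    (hnontriv : OK ≠ ⊤)
    (hext : ∀ x : K, x ∈ OK ↔ algebraMap K F x ∈ OF)
    (n k₁ k₂ k₃ k₄ : ℕ)
    (p : Fin k₁ → MvPolynomial (Fin n) K) (q : Fin k₂ → MvPolynomial (Fin n) K)
    (r s : Fin k₃ → MvPolynomial (Fin n) K) (t u : Fin k₄ → MvPolynomial (Fin n) K)
    (hF : ∃ x : Fin n → F,
      (∀ i, MvPolynomial.aeval x (p i) = 0) ∧ (∀ i, MvPolynomial.aeval x (q i) ≠ 0) ∧
      (∀ i, vle OF (MvPolynomial.aeval x (r i)) (MvPolynomial.aeval x (s i))) ∧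
      (∀ i, ¬ vle OF (MvPolynomial.aeval x (t i)) (MvPolynomial.aeval x (u i)))) :
    ∃ x : Fin n → K,
      (∀ i, MvPolynomial.aeval x (p i) = 0) ∧ (∀ i, MvPolynomial.aeval x (q i) ≠ 0) ∧
      (∀ i, vle OK (MvPolynomial.aeval x (r i)) (MvPolynomial.aeval x (s i))) ∧
      (∀ i, ¬ vle OK (MvPolynomial.aeval x (t i)) (MvPolynomial.aeval x (u i))) := by
  classical
  obtain ⟨x, h1, h2, h3, h4⟩ := hF
  obtain ⟨y, hy⟩ := ec_main OK OF hnontriv hext x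
    (insert 0 (Finset.univ.image p ∪ Finset.univ.image q ∪ Finset.univ.image r ∪
      Finset.univ.image s ∪ Finset.univ.image t ∪ Finset.univ.image u))
  have hz : ∀ P ∈ (insert 0 (Finset.univ.image p ∪ Finset.univ.image q ∪ Finset.univ.image r ∪
      Finset.univ.image s ∪ Finset.univ.image t ∪ Finset.univ.image u) :
        Finset (MvPolynomial (Fin n) K)),
      (MvPolynomial.aeval x P = 0 ↔ MvPolynomial.aeval y P = 0) := by
    intro P hP
    have := hy 0 (Finset.mem_insert_self _ _) P hP
    rwa [map_zero, map_zero, ec_vle_zero, ec_vle_zero] at this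
  refine ⟨y, fun i => (hz _ ?_).1 (h1 i), fun i => mt (hz _ ?_).2 (h2 i),
    fun i => (hy _ ?_ _ ?_).1 (h3 i), fun i => mt (hy _ ?_ _ ?_).2 (h4 i)⟩ <;> simp
end
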